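/- arXiv:2109.12643 — 5 statements merged into one kernel-verified Lean document; each statement's English description precedes it below -/
import Mathlib

section
/- Let N ≥ 2 and M ≥ 1 be integers with M ≤ N/(16·log N), where log denotes the natural logarithm. Then, with the probability taken uniformly over all functions h : Fin N → Fin M, the probability that every j : Fin M satisfies #{i : Fin N | h(i) = j} > N/(2M) is at least 1 − 1/(16·N·log N). Equivalently, the number of functions h : Fin N → Fin M such that every fiber h⁻¹(j) has cardinality strictly greater than N/(2M) is at least (1 − 1/(16·N·log N))·M^N. -/
open Finset

theorem sum_pow_card_fiber {κ R : Type*} [Fintype κ] [DecidableEq κ] [CommSemiring R]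
    (n : ℕ) (j : κ) (r : R) :
    ∑ h : Fin n → κ, r ^ #{i | h i = j} = (∑ k, if k = j then r else 1) ^ n := by
  rw [Fintype.sum_pow]
  refine sum_congr rfl fun h _ => ?_
  rw [prod_ite, prod_const, prod_const_one, mul_one]

theorem card_fiber_le_half_mean_le_exp (N M : ℕ) (hM : 1 ≤ M) (j : Fin M) :
    (#{h : Fin N → Fin M | (#{i | h i = j} : ℝ) ≤ N / (2 * M)} : ℝ) ≤
      (M : ℝ) ^ N * Real.exp (-(N / (8 * M))) := by
  have hM0 : (0 : ℝ) < M := by exact_mod_cast hM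
  have hM1 : (1 : ℝ) ≤ M := by exact_mod_cast hM
  set t : ℝ := N / (2 * M) with ht
  have ht0 : 0 ≤ t := by positivity
  have generating : ∑ h : Fin N → Fin M, (1 / 2 : ℝ) ^ #{i | h i = j} =
      ((M : ℝ) - 1 / 2) ^ N := by
    rw [sum_pow_card_fiber]
    congr 1
    have (k : Fin M) : (if k = j then (1 / 2 : ℝ) else 1) = 1 - if k = j then 1 / 2 else 0 := by
      split_ifs <;> norm_num
    simp_rw [this, sum_sub_distrib]
    simp
  have markov : (#{h : Fin N → Fin M | (#{i | h i = j} : ℝ) ≤ t} : ℝ) *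
      Real.exp (-(Real.log 2 * t)) ≤ ((M : ℝ) - 1 / 2) ^ N := by
    rw [← generating, ← nsmul_eq_mul]
    refine (card_nsmul_le_sum _ (fun h : Fin N → Fin M => (1 / 2 : ℝ) ^ #{i | h i = j}) _
      fun h hh => ?_).trans
      (sum_le_sum_of_subset_of_nonneg (subset_univ _) fun _ _ _ => by positivity)
    have hh' : (#{i | h i = j} : ℝ) ≤ t := by simpa using hh
    have hpow : (1 / 2 : ℝ) ^ #{i | h i = j} =
        Real.exp (-(Real.log 2 * (#{i | h i = j} : ℝ))) := by
      rw [one_div, inv_pow, Real.exp_neg, Real.exp_mul, Real.exp_log two_pos, Real.rpow_natCast]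
    rw [hpow]
    gcongr
  have base : ((M : ℝ) - 1 / 2) ^ N ≤ (M : ℝ) ^ N * Real.exp (-t) := by
    have hsplit : (M : ℝ) - 1 / 2 ≤ M * Real.exp (-(1 / (2 * M))) := by
      calc (M : ℝ) - 1 / 2 = M * (-(1 / (2 * M)) + 1) := by field_simp; ring
        _ ≤ _ := by gcongr; exact Real.add_one_le_exp _
    calc ((M : ℝ) - 1 / 2) ^ N ≤ (M * Real.exp (-(1 / (2 * M)))) ^ N :=
          pow_le_pow_left₀ (by linarith) hsplit N
      _ = _ := by
        rw [mul_pow, ← Real.exp_nat_mul, ht]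
        congr 2
        field_simp
  have hlog : Real.log 2 * t - t ≤ -(N / (8 * M)) := by
    have : (N : ℝ) / (8 * M) = t / 4 := by rw [ht, div_div]; ring_nf
    rw [this]
    nlinarith [Real.log_two_lt_d9]
  calc _ = _ * Real.exp (-(Real.log 2 * t)) * Real.exp (Real.log 2 * t) := by
        rw [mul_assoc, ← Real.exp_add, neg_add_cancel, Real.exp_zero, mul_one]
    _ ≤ (M : ℝ) ^ N * Real.exp (-t) * Real.exp (Real.log 2 * t) := by
        exact mul_le_mul_of_nonneg_right (markov.trans base) (Real.exp_pos _).le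
    _ = (M : ℝ) ^ N * Real.exp (Real.log 2 * t - t) := by
        rw [mul_assoc, ← Real.exp_add]
        ring_nf
    _ ≤ _ := by gcongr

theorem fibers_large_with_high_probability (N M : ℕ) (hN : 2 ≤ N) (hM : 1 ≤ M)
    (hMN : (M : ℝ) ≤ (N : ℝ) / (16 * Real.log N)) :
    (1 - 1 / (16 * (N : ℝ) * Real.log N)) * (M : ℝ) ^ N ≤
      (Nat.card {h : Fin N → Fin M //
        ∀ j : Fin M,
          (N : ℝ) / (2 * (M : ℝ)) <
            ((Finset.univ.filter fun i : Fin N => h i = j).card : ℝ)} : ℝ) := by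
  classical
  have hM0 : (0 : ℝ) < M := by exact_mod_cast hM
  have hN0 : (0 : ℝ) < N := by positivity
  have hL : 0 < Real.log N := Real.log_pos (by exact_mod_cast hN)
  have hMN' : (M : ℝ) * (16 * Real.log N) ≤ N := (le_div_iff₀ (by positivity)).1 hMN
  have hexp : Real.exp (-(N / (8 * M))) ≤ 1 / (N : ℝ) ^ 2 := by
    calc Real.exp (-(N / (8 * M))) ≤ Real.exp (-(2 * Real.log N)) := by
          gcongr
          rw [le_div_iff₀ (by positivity)]
          linarith
      _ = 1 / (N : ℝ) ^ 2 := by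
          rw [Real.exp_neg, two_mul, Real.exp_add, Real.exp_log hN0, one_div, sq]
  set good : Finset (Fin N → Fin M) := {h | ∀ j, (N : ℝ) / (2 * M) < #{i | h i = j}} with hgood
  have hcard : Nat.card {h : Fin N → Fin M // ∀ j : Fin M,
      (N : ℝ) / (2 * (M : ℝ)) < (#{i | h i = j} : ℝ)} = #good := by
    rw [Nat.card_eq_fintype_card, Fintype.card_subtype]
  rw [hcard]
  have hcompl : goodᶜ ⊆ univ.biUnion fun j : Fin M =>
      {h : Fin N → Fin M | (#{i | h i = j} : ℝ) ≤ N / (2 * M)} := by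
    intro h hh
    simpa [hgood] using hh
  have hbad : (#goodᶜ : ℝ) ≤ M * ((M : ℝ) ^ N * (1 / (N : ℝ) ^ 2)) := by
    calc (#goodᶜ : ℝ) ≤ ∑ j : Fin M,
          (#{h : Fin N → Fin M | (#{i | h i = j} : ℝ) ≤ N / (2 * M)} : ℝ) := by
          exact_mod_cast (card_le_card hcompl).trans card_biUnion_le
      _ ≤ ∑ _j : Fin M, (M : ℝ) ^ N * (1 / (N : ℝ) ^ 2) := by
          refine sum_le_sum fun j _ => (card_fiber_le_half_mean_le_exp N M hM j).trans ?_
          gcongr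
      _ = _ := by simp
  have htotal : (#good : ℝ) + #goodᶜ = (M : ℝ) ^ N := by
    have := card_add_card_compl good
    rw [Fintype.card_fun, Fintype.card_fin, Fintype.card_fin] at this
    exact_mod_cast this
  have hratio : (M : ℝ) * (1 / (N : ℝ) ^ 2) ≤ 1 / (16 * (N : ℝ) * Real.log N) := by
    rw [mul_one_div, div_le_div_iff₀ (by positivity) (by positivity)]
    nlinarith
  have hpow : (0 : ℝ) < (M : ℝ) ^ N := by positivity
  nlinarith [mul_le_mul_of_nonneg_left hratio hpow.le]
end

section
/- There exists a constant C > 0 such that for every integer i ≥ 1, the family of real numbers ( (2j−1)² / ((2j−1)² − (2i−1)²) ) indexed by integers j ≥ 1 with j ≠ i is multipliable (the infinite product converges), and the absolute value of the product ∏_{j ≥ 1, j ≠ i} (2j−1)² / ((2j−1)² − (2i−1)²) is at most C/i. -/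
open Filter Topology Finset

/-- The `j`-th factor of the product attached to `i`, with both indices starting at `0`. -/
noncomputable def oddFactor (i j : ℕ) : ℝ :=
  if j = i then 1 else (2 * (j : ℝ) + 1) ^ 2 / ((2 * (j : ℝ) + 1) ^ 2 - (2 * (i : ℝ) + 1) ^ 2)

lemma abs_oddFactor_mul (i j : ℕ) (h : j ≠ i) :
    |oddFactor i j| * (4 * |(j : ℝ) - i| * ((j : ℝ) + i + 1)) = (2 * (j : ℝ) + 1) ^ 2 := by
  have hji : (j : ℝ) - i ≠ 0 := sub_ne_zero.mpr (by exact_mod_cast h)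
  have hs : (0 : ℝ) < (j : ℝ) + i + 1 := by positivity
  have hd : (2 * (j : ℝ) + 1) ^ 2 - (2 * (i : ℝ) + 1) ^ 2 =
      4 * ((j : ℝ) - i) * ((j : ℝ) + i + 1) := by ring
  have habs : 0 < |(j : ℝ) - i| := abs_pos.mpr hji
  rw [oddFactor, if_neg h, hd, abs_div, abs_mul, abs_mul, abs_of_pos hs,
    abs_of_nonneg (sq_nonneg (2 * (j : ℝ) + 1)), abs_of_pos (by norm_num : (0 : ℝ) < 4)]
  exact div_mul_cancel₀ _ (by positivity)

lemma prod_range_sub_mul_add (i : ℕ) :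
    ∏ j ∈ range i, ((i - j) * (i + j + 1)) = (2 * i).factorial := by
  have h₁ : ∏ j ∈ range i, (i - j) = i.factorial := by
    rw [← prod_range_add_one_eq_factorial, ← prod_range_reflect]
    refine prod_congr rfl fun j hj => ?_
    have := mem_range.mp hj
    omega
  have h₂ : ∏ j ∈ range i, (i + j + 1) = (i + 1).ascFactorial i := by
    rw [Nat.ascFactorial_eq_prod_range]
    exact prod_congr rfl fun j _ => by ring
  rw [prod_mul_distrib, h₁, h₂, Nat.factorial_mul_ascFactorial, two_mul]

lemma prod_range_self_abs_oddFactor (i : ℕ) :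
    (∏ j ∈ range i, |oddFactor i j|) * (4 ^ i * ((2 * i).factorial : ℝ)) =
      ∏ j ∈ range i, (2 * (j : ℝ) + 1) ^ 2 := by
  have h4 : (4 : ℝ) ^ i = ∏ _j ∈ range i, (4 : ℝ) := by simp
  rw [← prod_range_sub_mul_add, Nat.cast_prod, h4, ← prod_mul_distrib, ← prod_mul_distrib]
  refine prod_congr rfl fun j hj => ?_
  have hj := mem_range.mp hj
  have hlt : (j : ℝ) < i := by exact_mod_cast hj
  rw [← abs_oddFactor_mul i j hj.ne, abs_of_neg (sub_neg.mpr hlt), Nat.cast_mul,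
    Nat.cast_sub hj.le]
  push_cast
  ring

lemma prod_range_abs_oddFactor (i k : ℕ) :
    (∏ j ∈ range (i + k + 1), |oddFactor i j|) *
        (4 ^ (i + k) * ((2 * (i : ℝ) + 1) * (k.factorial * (i + k + 1 + i).factorial))) =
      ∏ j ∈ range (i + k + 1), (2 * (j : ℝ) + 1) ^ 2 := by
  induction k with
  | zero =>
    rw [add_zero, prod_range_succ, prod_range_succ, ← prod_range_self_abs_oddFactor,
      show i + 1 + i = 2 * i + 1 by ring, Nat.factorial_succ]
    simp only [oddFactor, if_true, abs_one, Nat.factorial_zero]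
    push_cast
    ring
  | succ k ih =>
    have h := abs_oddFactor_mul i (i + k + 1) (by omega)
    have hk : |((i + k + 1 : ℕ) : ℝ) - i| = k + 1 := by
      rw [show ((i + k + 1 : ℕ) : ℝ) - i = k + 1 by push_cast; ring]
      exact abs_of_pos (by positivity)
    rw [hk] at h
    rw [← add_assoc, prod_range_succ, prod_range_succ _ (i + k + 1), ← ih, ← h,
      show i + k + 1 + 1 + i = (i + k + 1 + i) + 1 by ring, Nat.factorial_succ,
      Nat.factorial_succ]
    push_cast
    ring

lemma factorial_add_mul_factorial_le {k c : ℕ} (h : k ≤ c) (i : ℕ) :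
    (k + i).factorial * c.factorial ≤ k.factorial * (c + i).factorial := by
  induction i with
  | zero => simp
  | succ i ih =>
    rw [← add_assoc, ← add_assoc, Nat.factorial_succ, Nat.factorial_succ]
    calc (k + i + 1) * (k + i).factorial * c.factorial
        = (k + i + 1) * ((k + i).factorial * c.factorial) := by ring
      _ ≤ (c + i + 1) * (k.factorial * (c + i).factorial) := by gcongr
      _ = _ := by ring

lemma prod_range_odd_sq_le (n : ℕ) :
    ∏ j ∈ range (n + 1), (2 * (j : ℝ) + 1) ^ 2 ≤
      (2 - 1 / ((n : ℝ) + 1)) * (4 ^ n * (n.factorial * (n + 1).factorial)) := by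
  induction n with
  | zero => norm_num
  | succ n ih =>
    rw [prod_range_succ]
    have hstep : (2 - 1 / ((n : ℝ) + 1)) * (2 * ((n + 1 : ℕ) : ℝ) + 1) ^ 2 ≤
        (2 - 1 / (((n + 1 : ℕ) : ℝ) + 1)) * (4 * (((n : ℝ) + 1) * ((n : ℝ) + 2))) := by
      have hn : (0 : ℝ) ≤ n := n.cast_nonneg
      have e₁ : 2 - 1 / ((n : ℝ) + 1) = (2 * n + 1) / (n + 1) := by field_simp; ring
      have e₂ : 2 - 1 / (((n + 1 : ℕ) : ℝ) + 1) = (2 * n + 3) / (n + 2) := by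
        push_cast; field_simp; ring
      rw [e₁, e₂, div_mul_eq_mul_div, div_mul_eq_mul_div,
        div_le_div_iff₀ (by positivity) (by positivity)]
      push_cast
      have : 0 ≤ ((n : ℝ) + 2) * (2 * n + 3) := by positivity
      nlinarith
    calc _ ≤ (2 - 1 / ((n : ℝ) + 1)) * (4 ^ n * (n.factorial * (n + 1).factorial)) *
          (2 * ((n + 1 : ℕ) : ℝ) + 1) ^ 2 := by gcongr
      _ = (2 - 1 / ((n : ℝ) + 1)) * (2 * ((n + 1 : ℕ) : ℝ) + 1) ^ 2 *
          (4 ^ n * (n.factorial * (n + 1).factorial)) := by ring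
      _ ≤ _ := mul_le_mul_of_nonneg_right hstep (by positivity)
      _ = _ := by
        rw [Nat.factorial_succ (n + 1), Nat.factorial_succ n]
        push_cast
        ring

lemma prod_range_abs_oddFactor_le (i k : ℕ) :
    ∏ j ∈ range (i + k + 1), |oddFactor i j| ≤ 2 / (2 * (i : ℝ) + 1) := by
  have h := prod_range_abs_oddFactor i k
  have hfac : (((i + k).factorial * (i + k + 1).factorial : ℕ) : ℝ) ≤
      ((k.factorial * (i + k + 1 + i).factorial : ℕ) : ℝ) := by
    have := factorial_add_mul_factorial_le (show k ≤ i + k + 1 by omega) i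
    rw [add_comm k i] at this
    exact_mod_cast this
  push_cast at hfac
  set P := ∏ j ∈ range (i + k + 1), |oddFactor i j|
  have hP : 0 ≤ P := prod_nonneg fun _ _ => abs_nonneg _
  rw [le_div_iff₀ (by positivity)]
  have hpos : (0 : ℝ) < 4 ^ (i + k) * ((i + k).factorial * (i + k + 1).factorial) := by
    positivity
  refine le_of_mul_le_mul_right ?_ hpos
  calc P * (2 * (i : ℝ) + 1) * (4 ^ (i + k) * ((i + k).factorial * (i + k + 1).factorial))
      ≤ P * (2 * (i : ℝ) + 1) * (4 ^ (i + k) * (k.factorial * (i + k + 1 + i).factorial)) := by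
        gcongr
    _ = ∏ j ∈ range (i + k + 1), (2 * (j : ℝ) + 1) ^ 2 := by rw [← h]; ring
    _ ≤ _ := prod_range_odd_sq_le (i + k)
    _ ≤ _ := by
        gcongr
        exact sub_le_self _ (by positivity)

lemma summable_div_odd_sq_sub (c : ℝ) :
    Summable fun j : ℕ => c / ((2 * (j : ℝ) - 1) ^ 2 - c) := by
  refine Summable.of_norm_bounded_eventually_nat (g := fun j : ℕ => |c| * (1 / (j : ℝ) ^ 2))
    ((Real.summable_one_div_nat_pow.mpr one_lt_two).mul_left _) ?_
  filter_upwards [eventually_ge_atTop (⌈|c|⌉₊ + 2)] with j hj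
  have hc : |c| + 2 ≤ j := by
    have : ((⌈|c|⌉₊ + 2 : ℕ) : ℝ) ≤ j := by exact_mod_cast hj
    push_cast at this
    linarith [Nat.le_ceil |c|]
  have h₀ := abs_nonneg c
  have h₁ := le_abs_self c
  have hle : (j : ℝ) ^ 2 ≤ (2 * (j : ℝ) - 1) ^ 2 - c := by nlinarith
  have hj : (0 : ℝ) < (j : ℝ) ^ 2 := by
    have : (0 : ℝ) < j := by linarith
    positivity
  rw [Real.norm_eq_abs, abs_div, abs_of_pos (hj.trans_le hle), mul_one_div]
  gcongr

lemma multipliable_odd_sq_div (i : ℕ) (hi : 1 ≤ i) :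
    Multipliable (fun j : {j : ℕ // 1 ≤ j ∧ j ≠ i} =>
      (2 * ((j : ℕ) : ℝ) - 1) ^ 2 /
        ((2 * ((j : ℕ) : ℝ) - 1) ^ 2 - (2 * (i : ℝ) - 1) ^ 2)) := by
  have hs := ((summable_div_odd_sq_sub ((2 * (i : ℝ) - 1) ^ 2)).subtype
    {j : ℕ | 1 ≤ j ∧ j ≠ i})
  refine (Real.multipliable_one_add_of_summable hs).congr fun j => ?_
  obtain ⟨j, hj, hji⟩ := j
  have h₁ : (1 : ℝ) ≤ j := by exact_mod_cast hj
  have h₂ : (1 : ℝ) ≤ i := by exact_mod_cast hi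
  have h₃ : (j : ℝ) - i ≠ 0 := sub_ne_zero.mpr (by exact_mod_cast hji)
  have h₄ : (2 * (j : ℝ) - 1) ^ 2 - (2 * (i : ℝ) - 1) ^ 2 ≠ 0 := by
    rw [show (2 * (j : ℝ) - 1) ^ 2 - (2 * (i : ℝ) - 1) ^ 2 =
      4 * ((j : ℝ) - i) * ((j : ℝ) + i - 1) by ring]
    exact mul_ne_zero (mul_ne_zero four_ne_zero h₃) (by linarith)
  simp only [Function.comp_apply]
  rw [eq_div_iff h₄, add_mul, div_mul_cancel₀ _ h₄]
  ring

theorem infinite_product_bound :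
    ∃ C : ℝ, 0 < C ∧ ∀ i : ℕ, 1 ≤ i →
      Multipliable (fun j : {j : ℕ // 1 ≤ j ∧ j ≠ i} =>
        (2 * ((j : ℕ) : ℝ) - 1) ^ 2 /
          ((2 * ((j : ℕ) : ℝ) - 1) ^ 2 - (2 * (i : ℝ) - 1) ^ 2)) ∧
      |∏' j : {j : ℕ // 1 ≤ j ∧ j ≠ i},
          (2 * ((j : ℕ) : ℝ) - 1) ^ 2 /
            ((2 * ((j : ℕ) : ℝ) - 1) ^ 2 - (2 * (i : ℝ) - 1) ^ 2)| ≤ C / i := by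
  refine ⟨2, two_pos, fun i hi => ⟨multipliable_odd_sq_div i hi, ?_⟩⟩
  set f : ℕ → ℝ := fun j => (2 * (j : ℝ) - 1) ^ 2 /
    ((2 * (j : ℝ) - 1) ^ 2 - (2 * (i : ℝ) - 1) ^ 2) with hf
  set s : Set ℕ := {j | 1 ≤ j ∧ j ≠ i} with hs
  have hm : Multipliable (s.mulIndicator f) :=
    multipliable_subtype_iff_mulIndicator.mp (multipliable_odd_sq_div i hi)
  have ht : ∏' j : {j : ℕ // 1 ≤ j ∧ j ≠ i}, f j = ∏' j, s.mulIndicator f j :=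
    tprod_subtype s f
  change |∏' j : {j : ℕ // 1 ≤ j ∧ j ≠ i}, f j| ≤ _
  rw [ht]
  obtain ⟨m, rfl⟩ : ∃ m, i = m + 1 := ⟨i - 1, by omega⟩
  have hfactor (j : ℕ) : s.mulIndicator f (j + 1) = oddFactor m j := by
    by_cases h : j = m
    · simp [hs, oddFactor, h]
    · rw [Set.mulIndicator_of_mem (by simp [hs, h]), oddFactor, if_neg h, hf]
      push_cast
      ring_nf
  refine le_of_tendsto hm.hasProd.tendsto_prod_nat.abs ?_
  filter_upwards [eventually_ge_atTop (m + 2)] with N hN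
  obtain ⟨k, rfl⟩ : ∃ k, N = m + k + 1 + 1 := ⟨N - m - 2, by omega⟩
  rw [prod_range_succ', Set.mulIndicator_of_notMem (by simp [hs]), mul_one, abs_prod]
  simp only [hfactor]
  refine (prod_range_abs_oddFactor_le m k).trans ?_
  push_cast
  have hm0 : (0 : ℝ) ≤ m := m.cast_nonneg
  gcongr
  linarith
end

section
/- Let m be a positive integer and let H be a subgroup of (ℤ/mℤ)² that is cyclic of order m (i.e. H is generated by a single element and has exactly m elements). Then there exist integers d and c with d > 0, d ∣ m, gcd(d, c) = 1, such that the image of (d, c) in (ℤ/mℤ)² generates H. Moreover, d is unique: it is the only positive divisor d of m such that the image of (d, γ) in (ℤ/mℤ)² generates H for some integer γ. -/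
/-- Scaling by a unit of `ZMod m` does not change the cyclic subgroup generated by a pair. -/
theorem ZMod.zmultiples_unit_mul_pair {m : ℕ} (u : (ZMod m)ˣ) (x y : ZMod m) :
    AddSubgroup.zmultiples ((u : ZMod m) * x, (u : ZMod m) * y) =
      AddSubgroup.zmultiples (x, y) := by
  have mul_mem (v x y : ZMod m) : (v * x, v * y) ∈ AddSubgroup.zmultiples (x, y) := by
    obtain ⟨n, rfl⟩ := ZMod.intCast_surjective v
    exact AddSubgroup.mem_zmultiples_iff.2 ⟨n, by simp⟩
  apply le_antisymm <;> rw [AddSubgroup.zmultiples_le]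
  · exact mul_mem _ _ _
  · simpa using mul_mem ((u⁻¹ : (ZMod m)ˣ) : ZMod m) (u * x) (u * y)

/-- If the pair `(d, c)` has additive order `m` in `(ZMod m)²` and `d ∣ m`, then `d` and `c` are
coprime. -/
theorem ZMod.gcd_eq_one_of_addOrderOf_pair {m : ℕ} (hm : 0 < m) {d c : ℤ} (hd : d ∣ (m : ℤ))
    (h : addOrderOf ((d : ZMod m), (c : ZMod m)) = m) : Int.gcd d c = 1 := by
  obtain ⟨k, hk⟩ : Int.gcd d c ∣ m := Int.natCast_dvd_natCast.1 ((Int.gcd_dvd_left d c).trans hd)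
  have smul_eq_zero {x : ℤ} (hx : (Int.gcd d c : ℤ) ∣ x) : k • (x : ZMod m) = 0 := by
    have hdvd : (m : ℤ) ∣ k * x := by
      rw [hk, Nat.cast_mul, mul_comm]
      exact mul_dvd_mul_left _ hx
    simpa using (ZMod.intCast_zmod_eq_zero_iff_dvd _ m).2 hdvd
  have hmk : m ∣ k := by
    rw [← h]
    exact addOrderOf_dvd_of_nsmul_eq_zero
      (Prod.ext (smul_eq_zero (Int.gcd_dvd_left d c)) (smul_eq_zero (Int.gcd_dvd_right d c)))
  have hkm : k = m := Nat.dvd_antisymm ⟨_, hk.trans (mul_comm _ _)⟩ hmk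
  subst hkm
  exact Nat.eq_of_mul_eq_mul_right hm (by rw [one_mul]; exact hk.symm)

/-- A divisor `d` of `m` divides the first coordinate of every multiple of `(d, c)` modulo `m`. -/
theorem ZMod.dvd_of_pair_mem_zmultiples {m : ℕ} {d d' c c' : ℤ} (hd : d ∣ (m : ℤ))
    (h : ((d' : ZMod m), (c' : ZMod m)) ∈ AddSubgroup.zmultiples ((d : ZMod m), (c : ZMod m))) :
    d ∣ d' := by
  obtain ⟨n, hn⟩ := AddSubgroup.mem_zmultiples_iff.1 h
  have hfst : ((n * d : ℤ) : ZMod m) = (d' : ZMod m) := by simpa using congrArg Prod.fst hn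
  have hsub : d ∣ d' - n * d := hd.trans ((ZMod.intCast_eq_intCast_iff_dvd_sub _ _ m).1 hfst)
  exact (dvd_sub_left (dvd_mul_left d n)).1 hsub

theorem cyclic_subgroup_canonical_generator (m : ℕ) (hm : 0 < m)
    (H : AddSubgroup (ZMod m × ZMod m))
    (hcyc : ∃ g : ZMod m × ZMod m, H = AddSubgroup.zmultiples g)
    (hcard : Nat.card H = m) :
    ∃ d c : ℤ, 0 < d ∧ d ∣ (m : ℤ) ∧ Int.gcd d c = 1 ∧
      AddSubgroup.zmultiples (((d : ZMod m), (c : ZMod m))) = H ∧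
      ∀ d' : ℤ, 0 < d' → d' ∣ (m : ℤ) →
        (∃ γ : ℤ, AddSubgroup.zmultiples (((d' : ZMod m), (γ : ZMod m))) = H) →
        d' = d := by
  obtain ⟨⟨a, b⟩, hg⟩ := hcyc
  obtain ⟨d, hd, _, ⟨u, rfl⟩, rfl⟩ := ZMod.eq_unit_mul_divisor a
  obtain ⟨c, hc⟩ := ZMod.intCast_surjective (((u⁻¹ : (ZMod m)ˣ) : ZMod m) * b)
  have hgen : AddSubgroup.zmultiples (((d : ℤ) : ZMod m), (c : ZMod m)) = H := by
    rw [hg, ← ZMod.zmultiples_unit_mul_pair u, hc]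
    simp
  have hd' : (d : ℤ) ∣ (m : ℤ) := Int.natCast_dvd_natCast.2 hd
  have hd0 : (0 : ℤ) < d := Int.natCast_pos.2 (Nat.pos_of_dvd_of_pos hd hm)
  refine ⟨d, c, hd0, hd', ?_, hgen, ?_⟩
  · refine ZMod.gcd_eq_one_of_addOrderOf_pair hm hd' ?_
    rw [← Nat.card_zmultiples, hgen, hcard]
  · rintro e he0 he ⟨γ, hγ⟩
    apply Int.dvd_antisymm he0.le hd0.le
    · refine ZMod.dvd_of_pair_mem_zmultiples (c := γ) (c' := c) he ?_
      rw [hγ, ← hgen]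
      exact AddSubgroup.mem_zmultiples _
    · refine ZMod.dvd_of_pair_mem_zmultiples (c := c) (c' := γ) hd' ?_
      rw [hgen, ← hγ]
      exact AddSubgroup.mem_zmultiples _
end

section
/- Suppose d and b are positive integers, c and c' are integers with c ≡ c' (mod b), gcd(d, c) = 1 and gcd(d, c') = 1. Let m = d·b, and let H and H' be the cyclic subgroups of (ℤ/mℤ)² generated by the images of (d, c) and (d, c') respectively. Then H = H'. -/
theorem zmultiples_le_of_congruent_generators (d b : ℕ) (c c' : ℤ)
    (hcc : c ≡ c' [ZMOD (b : ℤ)]) (h : IsCoprime (d : ℤ) c) :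
    AddSubgroup.zmultiples ((((d : ℤ) : ZMod (d * b)), ((c' : ZMod (d * b))))) ≤
      AddSubgroup.zmultiples ((((d : ℤ) : ZMod (d * b)), ((c : ZMod (d * b))))) := by
  obtain ⟨u, v, huv⟩ := h
  obtain ⟨s, hs⟩ := hcc.dvd
  rw [AddSubgroup.zmultiples_le, AddSubgroup.mem_zmultiples_iff]
  refine ⟨1 + b * (s * v), ?_⟩
  rw [Prod.smul_mk, zsmul_eq_mul, zsmul_eq_mul, ← Int.cast_mul, ← Int.cast_mul, Prod.mk.injEq]
  constructor <;> rw [ZMod.intCast_eq_intCast_iff_dvd_sub] <;> push_cast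
  · exact ⟨-(s * v), by ring⟩
  · exact ⟨s * u, by linear_combination hs - b * s * huv⟩

theorem zmultiples_eq_of_congruent_generators (d b : ℕ) (hd : 0 < d) (hb : 0 < b)
    (c c' : ℤ) (hcc : c ≡ c' [ZMOD (b : ℤ)])
    (h1 : Int.gcd (d : ℤ) c = 1) (h2 : Int.gcd (d : ℤ) c' = 1) :
    AddSubgroup.zmultiples ((((d : ℤ) : ZMod (d * b)), ((c : ZMod (d * b))))) =
      AddSubgroup.zmultiples ((((d : ℤ) : ZMod (d * b)), ((c' : ZMod (d * b))))) :=
  le_antisymm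
    (zmultiples_le_of_congruent_generators d b c' c hcc.symm (Int.isCoprime_iff_gcd_eq_one.mpr h2))
    (zmultiples_le_of_congruent_generators d b c c' hcc (Int.isCoprime_iff_gcd_eq_one.mpr h1))
end

section
/- Let m be a positive integer and let H be a subgroup of the additive group (ℤ/mℤ)² with exactly m elements. Suppose that for every divisor r of m with 1 < r < m, the subgroup H is not contained in r·(ℤ/mℤ)² = {r·w : w ∈ (ℤ/mℤ)²}, and r·(ℤ/mℤ)² is not contained in H. Then H is cyclic (of order m). -/
theorem ZMod.exists_nsmul_eq_of_nsmul_eq_zero {m e r : ℕ} (hm : 0 < m) (her : m = e * r)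
    (x : ZMod m) (hx : e • x = 0) : ∃ y : ZMod m, r • y = x := by
  have : NeZero m := ⟨hm.ne'⟩
  have he : 0 < e := Nat.pos_of_ne_zero fun h0 => by simp [h0] at her; omega
  have hdvd : m ∣ e * x.val := by
    rw [← ZMod.natCast_eq_zero_iff, Nat.cast_mul, ZMod.natCast_zmod_val, ← nsmul_eq_mul, hx]
  obtain ⟨k, hk⟩ : r ∣ x.val := Nat.dvd_of_mul_dvd_mul_left he (her.symm.dvd.trans hdvd)
  refine ⟨k, ?_⟩
  rw [nsmul_eq_mul, ← Nat.cast_mul, ← hk, ZMod.natCast_zmod_val]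

theorem cyclic_of_not_comparable_with_scaled_subgroups (m : ℕ) (hm : 0 < m)
    (H : AddSubgroup (ZMod m × ZMod m)) (hcard : Nat.card H = m)
    (hr : ∀ r : ℕ, r ∣ m → 1 < r → r < m →
      ¬((H : Set (ZMod m × ZMod m)) ⊆
          Set.range (fun w : ZMod m × ZMod m => r • w)) ∧
      ¬(Set.range (fun w : ZMod m × ZMod m => r • w) ⊆
          (H : Set (ZMod m × ZMod m)))) :
    ∃ g : ZMod m × ZMod m, H = AddSubgroup.zmultiples g := by
  have : NeZero m := ⟨hm.ne'⟩
  obtain ⟨r, her⟩ : AddMonoid.exponent H ∣ m :=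
    AddGroup.exponent_dvd_nat_card.trans hcard.dvd
  have hr0 : 0 < r := Nat.pos_of_ne_zero fun h0 => by simp [h0] at her; omega
  have hr1 : r = 1 := by
    by_contra hne
    have he : AddMonoid.exponent H ≠ 1 := by
      intro h1
      have : Subsingleton H := AddMonoid.exp_eq_one_iff.mp h1
      have : m = 1 := hcard.symm.trans (Nat.card_of_subsingleton (0 : H))
      rw [h1, one_mul] at her
      omega
    have hlt : r < m := by
      have : AddMonoid.exponent H ≠ 0 := fun h0 => by simp [h0] at her; omega
      have : 2 ≤ AddMonoid.exponent H := by omega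
      nlinarith
    refine (hr r (Dvd.intro_left _ her.symm) (by omega) hlt).1 ?_
    rintro ⟨a, b⟩ hab
    have h0 : AddMonoid.exponent H • (a, b) = 0 :=
      congrArg Subtype.val (AddMonoid.exponent_nsmul_eq_zero (⟨(a, b), hab⟩ : H))
    obtain ⟨c, hc⟩ :=
      ZMod.exists_nsmul_eq_of_nsmul_eq_zero hm her a (congrArg Prod.fst h0)
    obtain ⟨d, hd⟩ :=
      ZMod.exists_nsmul_eq_of_nsmul_eq_zero hm her b (congrArg Prod.snd h0)
    exact ⟨(c, d), Prod.ext hc hd⟩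
  have hcyc : IsAddCyclic H := IsAddCyclic.of_exponent_eq_card (by
    rw [hr1, mul_one] at her
    exact her.symm.trans hcard.symm)
  obtain ⟨g, hg⟩ := (AddSubgroup.isAddCyclic_iff_exists_zmultiples_eq_top H).mp hcyc
  exact ⟨g, hg.symm⟩
end
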